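/- Let A be an increasing property of graphs on a vertex set of size n, let p = p(n) and m = m(n) satisfy m·p² < 1 and n·p → ∞, let ω = ω(n) → ∞ with ω = o(√(m·n·p)), and set p̂₋ = (m·p/n)·(1 − ω/√(m·n·p) − 2/(n·p) − m·p/(2n)). If the probability that the Erdős–Rényi random graph G(n,p̂₋) has property A tends to 1 as n → ∞, then the probability that the random intersection graph G(n,m,p) has property A also tends to 1 as n → ∞. -/

import Mathlib

open scoped Classical
open Filter

noncomputable section

/-- The (simple) graph determined by a feature assignment `W` on vertex set `Fin n`
with feature set `Fin m`: two distinct vertices are adjacent iff their feature sets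
intersect. -/
def rigGraph (n m : ℕ) (W : Fin n → Finset (Fin m)) : SimpleGraph (Fin n) :=
  SimpleGraph.fromRel (fun u v => ((W u) ∩ (W v)).Nonempty)

/-- The probability of the feature assignment `W` when each of the `m` features is
included in each vertex's feature set independently with probability `p`. -/
def assignWeight (n m : ℕ) (p : ℝ) (W : Fin n → Finset (Fin m)) : ℝ :=
  ∏ v : Fin n, p ^ (W v).card * (1 - p) ^ (m - (W v).card)

/-- The probability that the random intersection graph `G(n,m,p)` lies in the set `A`. -/
def rigProb (n m : ℕ) (p : ℝ) (A : Set (SimpleGraph (Fin n))) : ℝ :=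
  ∑ W : Fin n → Finset (Fin m), if rigGraph n m W ∈ A then assignWeight n m p W else 0

/-- The probability of the graph `G` under the Erdős–Rényi model `G(n, q)`, in which
each of the `n.choose 2` possible edges appears independently with probability `q`. -/
def erDist (n : ℕ) (q : ℝ) (G : SimpleGraph (Fin n)) : ℝ :=
  q ^ G.edgeSet.ncard * (1 - q) ^ (n.choose 2 - G.edgeSet.ncard)

/-- The probability that the Erdős–Rényi random graph `G(n, q)` lies in the set `A`. -/
def erProb (n : ℕ) (q : ℝ) (A : Set (SimpleGraph (Fin n))) : ℝ :=
  ∑ G : SimpleGraph (Fin n), if G ∈ A then erDist n q G else 0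

/-- The average of `φ (insert e S)` over a uniformly random element `e`. -/
def insertAvg {E : Type*} [Fintype E] [DecidableEq E] (φ : Finset E → ℝ) (S : Finset E) : ℝ :=
  (∑ e, φ (insert e S)) / Fintype.card E

section InsertAvg

variable {E : Type*} [Fintype E] [DecidableEq E]

lemma insertAvg_iterate_apply (φ : Finset E → ℝ) (j : ℕ) (S : Finset E) :
    insertAvg^[j] φ S =
      (∑ f : Fin j → E, φ (S ∪ Finset.univ.image f)) / (Fintype.card E : ℝ) ^ j := by
  induction j generalizing S with
  | zero => simp
  | succ j ih =>
    rw [Function.iterate_succ_apply', insertAvg]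
    simp_rw [ih]
    rw [← (Fin.consEquiv fun _ : Fin (j + 1) => E).sum_comp, Fintype.sum_prod_type,
      ← Finset.sum_div, div_div, pow_succ]
    congr 1
    refine Finset.sum_congr rfl fun e _ => Finset.sum_congr rfl fun f _ => ?_
    congr 1
    ext x
    simp [Fin.consEquiv, Fin.exists_fin_succ, eq_comm, or_left_comm]

lemma Monotone.insertAvg {φ : Finset E → ℝ} (h : Monotone φ) : Monotone (insertAvg φ) := by
  intro S T hST
  unfold _root_.insertAvg
  gcongr
  exact h (Finset.insert_subset_insert _ hST)

lemma Monotone.insertAvg_iterate {φ : Finset E → ℝ} (h : Monotone φ) (j : ℕ) :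
    Monotone (_root_.insertAvg^[j] φ) := by
  induction j with
  | zero => exact h
  | succ j ih => rw [Function.iterate_succ_apply']; exact ih.insertAvg

lemma le_insertAvg [Nonempty E] {φ : Finset E → ℝ} (h : Monotone φ) : φ ≤ insertAvg φ := by
  intro S
  rw [insertAvg, le_div_iff₀ (Nat.cast_pos.2 Fintype.card_pos), mul_comm, ← nsmul_eq_mul]
  exact Finset.card_nsmul_le_sum _ _ _ fun e _ => h (Finset.subset_insert e S)

lemma monotone_insertAvg_iterate [Nonempty E] {φ : Finset E → ℝ} (h : Monotone φ) :
    Monotone fun j => insertAvg^[j] φ :=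
  monotone_nat_of_le_succ fun j => by
    rw [Function.iterate_succ_apply']
    exact le_insertAvg (h.insertAvg_iterate j)

lemma insertAvg_iterate_nonneg {φ : Finset E → ℝ} (h : 0 ≤ φ) (j : ℕ) (S : Finset E) :
    0 ≤ insertAvg^[j] φ S := by
  rw [insertAvg_iterate_apply]
  exact div_nonneg (Finset.sum_nonneg fun f _ => h _) (by positivity)

lemma insertAvg_iterate_le_one [Nonempty E] {φ : Finset E → ℝ} (h : φ ≤ 1) (j : ℕ)
    (S : Finset E) : insertAvg^[j] φ S ≤ 1 := by
  rw [insertAvg_iterate_apply, div_le_one (by have := Fintype.card_pos (α := E); positivity)]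
  refine (Finset.sum_le_card_nsmul _ _ 1 fun f _ => h (S ∪ Finset.univ.image f)).trans ?_
  simp

/-- Exponential generating function of the number of maps `Fin N → E` with image `S`. -/
lemma hasSum_card_image_eq (t : ℝ) (S : Finset E) :
    HasSum (fun N : ℕ => t ^ N / N.factorial *
      (Finset.univ.filter fun f : Fin N → E => Finset.univ.image f = S).card)
      ((Real.exp t - 1) ^ S.card) := by
  induction S using Finset.strongInduction with
  | H S ih =>
  have hcount (N : ℕ) : ((S.card : ℝ)) ^ N = ∑ T ∈ S.powerset,
      ((Finset.univ.filter fun f : Fin N → E => Finset.univ.image f = T).card : ℝ) := by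
    have h1 : (Finset.univ.filter fun f : Fin N → E => Finset.univ.image f ⊆ S).card
        = S.card ^ N := by
      rw [← Fintype.card_piFinset_const]
      congr 1
      ext f
      simp [Finset.subset_iff]
    rw [← Nat.cast_pow, ← h1, ← Nat.cast_sum,
      Finset.card_eq_sum_card_fiberwise (f := fun f : Fin N → E => Finset.univ.image f)
        (t := S.powerset) (fun f hf => Finset.mem_powerset.2 (Finset.mem_filter.1 hf).2)]
    congr 1
    refine Finset.sum_congr rfl fun T hT => ?_
    congr 1
    ext f
    simp only [Finset.mem_filter, Finset.mem_univ, true_and, and_iff_right_iff_imp]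
    rintro rfl
    exact Finset.mem_powerset.1 hT
  have hexp : HasSum (fun N : ℕ => t ^ N / N.factorial * (S.card : ℝ) ^ N)
      (Real.exp t ^ S.card) := by
    have := NormedSpace.expSeries_div_hasSum_exp (t * S.card : ℝ)
    rw [← Real.exp_eq_exp_ℝ, mul_comm t, Real.exp_nat_mul] at this
    refine this.congr_fun ?_
    intro N
    rw [mul_pow]
    ring
  have hsub := hexp.sub (hasSum_sum fun T hT => ih T (Finset.mem_ssubsets.1 hT))
  have hbin : Real.exp t ^ S.card - ∑ T ∈ S.ssubsets, (Real.exp t - 1) ^ T.card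
      = (Real.exp t - 1) ^ S.card := by
    have := Finset.sum_pow_mul_eq_add_pow (Real.exp t - 1) 1 S
    simp only [one_pow, mul_one, sub_add_cancel] at this
    rw [← this, Finset.ssubsets, ← Finset.add_sum_erase _ _ (Finset.mem_powerset_self S)]
    ring
  rw [hbin] at hsub
  refine hsub.congr_fun ?_
  intro N
  rw [← Finset.mul_sum, ← mul_sub, hcount, Finset.ssubsets,
    ← Finset.add_sum_erase _ _ (Finset.mem_powerset_self S)]
  ring

/-- Inserting a Poisson number of uniformly random elements includes each element
independently. -/
lemma hasSum_poisson_insertAvg_iterate [Nonempty E] (φ : Finset E → ℝ) (t : ℝ) :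
    HasSum (fun N : ℕ => Real.exp (-(Fintype.card E * t)) *
        ((Fintype.card E * t) ^ N / N.factorial) * insertAvg^[N] φ ∅)
      (∑ S : Finset E, φ S * ((1 - Real.exp (-t)) ^ S.card *
        Real.exp (-t) ^ (Fintype.card E - S.card))) := by
  have hK : (Fintype.card E : ℝ) ≠ 0 := by exact_mod_cast Fintype.card_ne_zero
  have h := (hasSum_sum (s := Finset.univ) fun (S : Finset E) _ =>
    (hasSum_card_image_eq t S).mul_left (φ S)).mul_left (Real.exp (-(Fintype.card E * t)))
  have hER : ∑ S : Finset E, φ S * ((1 - Real.exp (-t)) ^ S.card *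
        Real.exp (-t) ^ (Fintype.card E - S.card))
      = Real.exp (-(Fintype.card E * t)) * ∑ S : Finset E, φ S * (Real.exp t - 1) ^ S.card := by
    rw [Finset.mul_sum]
    refine Finset.sum_congr rfl fun S _ => ?_
    have hS : S.card ≤ Fintype.card E := Finset.card_le_univ S
    have h1 : Real.exp (-(Fintype.card E * t))
        = Real.exp (-t) ^ S.card * Real.exp (-t) ^ (Fintype.card E - S.card) := by
      rw [← pow_add, Nat.add_sub_cancel' hS, ← Real.exp_nat_mul, mul_neg]
    have h2 : 1 - Real.exp (-t) = Real.exp (-t) * (Real.exp t - 1) := by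
      rw [mul_sub, ← Real.exp_add]
      simp
    rw [h1, h2, mul_pow]
    ring
  rw [hER]
  refine h.congr_fun ?_
  intro N
  have hsum : ∑ f : Fin N → E, φ (∅ ∪ Finset.univ.image f) = ∑ S : Finset E, φ S *
      ((Finset.univ.filter fun f : Fin N → E => Finset.univ.image f = S).card : ℝ) := by
    rw [← Finset.sum_fiberwise Finset.univ (fun f : Fin N → E => Finset.univ.image f)]
    refine Finset.sum_congr rfl fun S _ => ?_
    rw [Finset.sum_congr rfl (g := fun _ => φ S) (by
      intro f hf
      rw [Finset.empty_union, (Finset.mem_filter.1 hf).2])]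
    rw [Finset.sum_const, nsmul_eq_mul, mul_comm]
  rw [insertAvg_iterate_apply, hsum, mul_assoc]
  congr 1
  rw [mul_pow, Finset.sum_div, Finset.mul_sum]
  refine Finset.sum_congr rfl fun S _ => ?_
  field_simp

end InsertAvg

/-- Unordered pairs of distinct vertices. -/
abbrev VertexPair (V : Type*) := {e : Sym2 V // ¬ e.IsDiag}

/-- The pairs of distinct vertices inside `U`. -/
def cliquePairs {V : Type*} [Fintype V] [DecidableEq V] (U : Finset V) :
    Finset (VertexPair V) :=
  Finset.univ.filter fun e => ∀ v ∈ e.1, v ∈ U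

section Clique

variable {V : Type*} [Fintype V] [DecidableEq V]

@[simp] lemma mem_cliquePairs {U : Finset V} {e : VertexPair V} :
    e ∈ cliquePairs U ↔ ∀ v ∈ e.1, v ∈ U := by
  simp [cliquePairs]

/-- The action of a vertex permutation on pairs. -/
def vertexPairPerm (σ : Equiv.Perm V) : Equiv.Perm (VertexPair V) :=
  Equiv.ofBijective
    (fun e => ⟨e.1.map σ, (Sym2.isDiag_map σ.injective).not.2 e.2⟩)
    (Finite.injective_iff_bijective.1 fun _ _ h =>
      Subtype.ext (Sym2.map.injective σ.injective (Subtype.ext_iff.1 h)))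

lemma exists_perm_subset_map {X U : Finset V} (h : X.card ≤ U.card) :
    ∃ τ : Equiv.Perm V, X ⊆ U.map τ.toEmbedding := by
  obtain ⟨Y, hXY, hY⟩ := Finset.exists_superset_card_eq h (Finset.card_le_univ U)
  let e : {x // x ∈ U} ≃ {x // x ∈ Y} := Finset.equivOfCardEq hY.symm
  refine ⟨e.extendSubtype, hXY.trans ?_⟩
  refine (Finset.eq_of_subset_of_card_le ?_ (by simp [hY])).ge
  intro y hy
  obtain ⟨x, hx, rfl⟩ := Finset.mem_map.1 hy
  exact e.extendSubtype_mem x hx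

lemma sum_perm_insertAvg_iterate_le [Nonempty (VertexPair V)]
    {ψ : Finset (VertexPair V) → ℝ} (hψ : Monotone ψ)
    (U : Finset V) :
    (Fintype.card (Equiv.Perm V) : ℝ) * insertAvg^[U.card / 2] ψ ∅ ≤
      ∑ σ : Equiv.Perm V, ψ (cliquePairs (U.map σ.toEmbedding)) := by
  set j := U.card / 2 with hj
  have hperm (σ : Equiv.Perm V) :
      ∑ f : Fin j → VertexPair V, ψ (Finset.univ.image f) =
        ∑ f : Fin j → VertexPair V, ψ (Finset.univ.image (vertexPairPerm σ ∘ f)) :=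
    ((Equiv.arrowCongr (Equiv.refl (Fin j)) (vertexPairPerm σ)).sum_comp
      fun f => ψ (Finset.univ.image f)).symm
  have hf (f : Fin j → VertexPair V) :
      ∑ σ : Equiv.Perm V, ψ (Finset.univ.image (vertexPairPerm σ ∘ f)) ≤
        ∑ σ : Equiv.Perm V, ψ (cliquePairs (U.map σ.toEmbedding)) := by
    have hcard : (Finset.univ.biUnion fun i => (f i).1.toFinset).card ≤ U.card := by
      refine (Finset.card_biUnion_le_card_mul _ _ 2 fun i _ => ?_).trans ?_
      · exact (Sym2.card_toFinset_of_not_isDiag _ (f i).2).le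
      · simp only [Finset.card_univ, Fintype.card_fin]
        omega
    obtain ⟨τ, hτ⟩ := exists_perm_subset_map hcard
    rw [← Equiv.sum_comp (Equiv.mulRight τ)
      fun σ : Equiv.Perm V => ψ (cliquePairs (U.map σ.toEmbedding))]
    refine Finset.sum_le_sum fun σ _ => hψ ?_
    intro e he
    obtain ⟨i, -, rfl⟩ := Finset.mem_image.1 he
    rw [mem_cliquePairs]
    intro v hv
    obtain ⟨u, hu, rfl⟩ := Sym2.mem_map.1 hv
    have := hτ (Finset.mem_biUnion.2 ⟨i, Finset.mem_univ i, Sym2.mem_toFinset.2 hu⟩)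
    obtain ⟨x, hx, rfl⟩ := Finset.mem_map.1 this
    exact Finset.mem_map.2 ⟨x, hx, rfl⟩
  have hK : (0 : ℝ) < (Fintype.card (VertexPair V) : ℝ) ^ j := by
    have := Fintype.card_pos (α := VertexPair V)
    positivity
  rw [insertAvg_iterate_apply, mul_div_assoc', div_le_iff₀ hK]
  simp only [Finset.empty_union]
  calc _ = ∑ σ : Equiv.Perm V, ∑ f : Fin j → VertexPair V,
          ψ (Finset.univ.image (vertexPairPerm σ ∘ f)) := by
        rw [Finset.sum_congr rfl fun σ _ => (hperm σ).symm, Finset.sum_const, nsmul_eq_mul,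
          Finset.card_univ]
    _ ≤ ∑ f : Fin j → VertexPair V,
          ∑ σ : Equiv.Perm V, ψ (cliquePairs (U.map σ.toEmbedding)) := by
        rw [Finset.sum_comm]
        exact Finset.sum_le_sum fun f _ => hf f
    _ = _ := by
        rw [Finset.sum_const, nsmul_eq_mul, Finset.card_univ, mul_comm]
        simp

lemma insertAvg_iterate_union (φ : Finset (VertexPair V) → ℝ) (j : ℕ)
    (S T : Finset (VertexPair V)) :
    insertAvg^[j] (fun R => φ (S ∪ R)) T = insertAvg^[j] φ (S ∪ T) := by
  simp_rw [insertAvg_iterate_apply, Finset.union_assoc]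

/-- The law of a random clique whose vertex set has an exchangeable distribution dominates that
of half as many uniformly random pairs as there are vertices. -/
lemma sum_weight_insertAvg_iterate_le [Nonempty (VertexPair V)]
    {φ : Finset (VertexPair V) → ℝ} (hφ : Monotone φ)
    {w : ℕ → ℝ} (hw : ∀ k ≤ Fintype.card V, 0 ≤ w k) (S : Finset (VertexPair V)) :
    ∑ U : Finset V, w U.card * insertAvg^[U.card / 2] φ S ≤
      ∑ U : Finset V, w U.card * φ (S ∪ cliquePairs U) := by
  have hψ : Monotone fun R => φ (S ∪ R) :=
    fun R T h => hφ (Finset.union_subset_union_right h)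
  have hσ (σ : Equiv.Perm V) : ∑ U : Finset V, w U.card * φ (S ∪ cliquePairs U) =
      ∑ U : Finset V, w U.card * φ (S ∪ cliquePairs (U.map σ.toEmbedding)) := by
    rw [← (Equiv.finsetCongr σ).sum_comp]
    simp
  have hpos : (0 : ℝ) < Fintype.card (Equiv.Perm V) := Nat.cast_pos.2 Fintype.card_pos
  refine le_of_mul_le_mul_left ?_ hpos
  calc _ = ∑ U : Finset V, w U.card * ((Fintype.card (Equiv.Perm V) : ℝ) *
          insertAvg^[U.card / 2] (fun R => φ (S ∪ R)) ∅) := by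
        rw [Finset.mul_sum]
        refine Finset.sum_congr rfl fun U _ => ?_
        rw [insertAvg_iterate_union, Finset.union_empty]
        ring
    _ ≤ ∑ U : Finset V, w U.card * ∑ σ : Equiv.Perm V,
          φ (S ∪ cliquePairs (U.map σ.toEmbedding)) :=
        Finset.sum_le_sum fun U _ => mul_le_mul_of_nonneg_left
          (sum_perm_insertAvg_iterate_le hψ U) (hw _ (Finset.card_le_univ U))
    _ = ∑ σ : Equiv.Perm V, ∑ U : Finset V,
          w U.card * φ (S ∪ cliquePairs (U.map σ.toEmbedding)) := by
        simp_rw [Finset.mul_sum]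
        exact Finset.sum_comm
    _ = _ := by
        rw [Finset.sum_congr rfl fun σ _ => (hσ σ).symm, Finset.sum_const, nsmul_eq_mul,
          Finset.card_univ]

/-- Domination of uniformly random pairs by a union of random cliques. -/
lemma sum_prod_weight_insertAvg_iterate_le [Nonempty (VertexPair V)]
    {w : ℕ → ℝ} (hw : ∀ k ≤ Fintype.card V, 0 ≤ w k) (m : ℕ)
    {φ : Finset (VertexPair V) → ℝ} (hφ : Monotone φ) (S : Finset (VertexPair V)) :
    ∑ U : Fin m → Finset V, (∏ i, w (U i).card) * insertAvg^[∑ i, (U i).card / 2] φ S ≤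
      ∑ U : Fin m → Finset V, (∏ i, w (U i).card) *
        φ (S ∪ Finset.univ.biUnion fun i => cliquePairs (U i)) := by
  induction m generalizing S with
  | zero => simp
  | succ m ih =>
    have hw' (U : Finset V) : 0 ≤ w U.card := hw _ (Finset.card_le_univ U)
    rw [← (Fin.consEquiv fun _ : Fin (m + 1) => Finset V).sum_comp,
      ← (Fin.consEquiv fun _ : Fin (m + 1) => Finset V).sum_comp, Fintype.sum_prod_type,
      Fintype.sum_prod_type]
    simp only [Fin.consEquiv, Equiv.coe_fn_mk, Fin.prod_univ_succ, Fin.sum_univ_succ,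
      Fin.cons_zero, Fin.cons_succ]
    have hU (U : Finset V) (U' : Fin m → Finset V) :
        S ∪ Finset.univ.biUnion (fun i : Fin (m + 1) =>
            cliquePairs (Fin.cons (α := fun _ => Finset V) U U' i)) =
          (S ∪ cliquePairs U) ∪ Finset.univ.biUnion fun i => cliquePairs (U' i) := by
      ext e
      simp [Fin.exists_fin_succ]
    simp_rw [hU, Function.iterate_add_apply, mul_assoc]
    calc _ = ∑ U' : Fin m → Finset V, (∏ i, w (U' i).card) * ∑ U : Finset V, w U.card *
            insertAvg^[U.card / 2] (insertAvg^[∑ i, (U' i).card / 2] φ) S := by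
          rw [Finset.sum_comm]
          refine Finset.sum_congr rfl fun U' _ => ?_
          rw [Finset.mul_sum]
          exact Finset.sum_congr rfl fun U _ => by ring
      _ ≤ ∑ U' : Fin m → Finset V, (∏ i, w (U' i).card) * ∑ U : Finset V, w U.card *
            insertAvg^[∑ i, (U' i).card / 2] φ (S ∪ cliquePairs U) :=
          Finset.sum_le_sum fun U' _ => mul_le_mul_of_nonneg_left
            (sum_weight_insertAvg_iterate_le (hφ.insertAvg_iterate _) hw S)
            (Finset.prod_nonneg fun i _ => hw' _)
      _ = ∑ U : Finset V, w U.card * ∑ U' : Fin m → Finset V, (∏ i, w (U' i).card) *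
            insertAvg^[∑ i, (U' i).card / 2] φ (S ∪ cliquePairs U) := by
          simp_rw [Finset.mul_sum]
          rw [Finset.sum_comm]
          exact Finset.sum_congr rfl fun U _ => Finset.sum_congr rfl fun U' _ => by ring
      _ ≤ _ := by
          refine Finset.sum_le_sum fun U _ => ?_
          rw [← Finset.mul_sum]
          exact mul_le_mul_of_nonneg_left (ih _) (hw' U)

end Clique

lemma hasSum_poisson_mgf (l s : ℝ) :
    HasSum (fun N : ℕ => Real.exp (-l) * (l ^ N / N.factorial) * Real.exp s ^ N)
      (Real.exp (l * (Real.exp s - 1))) := by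
  have h := (NormedSpace.expSeries_div_hasSum_exp (l * Real.exp s)).mul_left (Real.exp (-l))
  rw [← Real.exp_eq_exp_ℝ, ← Real.exp_add, show -l + l * Real.exp s = l * (Real.exp s - 1) by ring]
    at h
  refine h.congr_fun ?_
  intro N
  rw [mul_pow]
  ring

/-- Exponential Markov comparison of a Poisson number of insertions with `N` insertions. -/
lemma poisson_sub_le_insertAvg_iterate {E : Type*} [Fintype E] [DecidableEq E] [Nonempty E]
    {φ : Finset E → ℝ} (hφ : Monotone φ) (h0 : 0 ≤ φ) (h1 : φ ≤ 1) {t s : ℝ} (ht : 0 ≤ t)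
    (hs : 0 ≤ s) (N : ℕ) :
    ∑ S : Finset E, φ S * ((1 - Real.exp (-t)) ^ S.card *
        Real.exp (-t) ^ (Fintype.card E - S.card)) -
      Real.exp (Fintype.card E * t * (Real.exp s - 1) - s) * Real.exp (-(s * N)) ≤
      insertAvg^[N] φ ∅ := by
  have hone := (hasSum_poisson_mgf (Fintype.card E * t) 0).mul_right (insertAvg^[N] φ ∅)
  have hs' := (hasSum_poisson_mgf (Fintype.card E * t) s).mul_right (Real.exp (-s - s * N))
  have hER := hasSum_poisson_insertAvg_iterate φ t
  have key := hasSum_le (fun M => ?_) hER (hone.add hs')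
  · simp only [Real.exp_zero, sub_self, mul_zero, one_mul] at key
    rw [← Real.exp_add] at key ⊢
    rw [show Fintype.card E * t * (Real.exp s - 1) - s + -(s * N)
      = Fintype.card E * t * (Real.exp s - 1) + (-s - s * N) by ring]
    linarith
  · have hπ : 0 ≤ Real.exp (-(Fintype.card E * t)) *
        ((Fintype.card E * t) ^ M / M.factorial) := by positivity
    simp only [Real.exp_zero, one_pow, mul_one]
    rw [mul_assoc _ (Real.exp s ^ M), ← mul_add]
    refine mul_le_mul_of_nonneg_left ?_ hπ
    rw [← Real.exp_nat_mul, ← Real.exp_add]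
    rcases le_or_gt M N with h | h
    · have := monotone_insertAvg_iterate hφ h ∅
      have := Real.exp_pos (M * s + (-s - s * N))
      simp only at *
      linarith
    · have h2 := insertAvg_iterate_le_one h1 M ∅
      have h3 := insertAvg_iterate_nonneg h0 N ∅
      have h4 : (N : ℝ) + 1 ≤ M := by exact_mod_cast h
      have h5 := Real.one_le_exp (x := M * s + (-s - s * N)) (by nlinarith)
      linarith

/-- Laplace transform bound for the total of `⌊|Uᵢ| / 2⌋` over `m` independent binomial random
subsets. -/
lemma sum_prod_weight_exp_le {V : Type*} [Fintype V] {p : ℝ} (hp0 : 0 ≤ p) (hp1 : p ≤ 1)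
    (m : ℕ) {s : ℝ} (hs : 0 ≤ s) :
    ∑ U : Fin m → Finset V, (∏ i, p ^ (U i).card * (1 - p) ^ (Fintype.card V - (U i).card)) *
        Real.exp (-(s * (∑ i, (U i).card / 2 : ℕ))) ≤
      (Real.exp (s / 2) * (p * Real.exp (-(s / 2)) + (1 - p)) ^ Fintype.card V) ^ m := by
  rw [← Fintype.sum_pow_mul_eq_add_pow, Finset.mul_sum, Fintype.sum_pow]
  have hp : 0 ≤ 1 - p := sub_nonneg.2 hp1
  refine Finset.sum_le_sum fun U _ => ?_
  rw [Nat.cast_sum, Finset.mul_sum, ← Finset.sum_neg_distrib, Real.exp_sum,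
    ← Finset.prod_mul_distrib]
  refine Finset.prod_le_prod (fun i _ => by positivity) fun i _ => ?_
  have h2 : ((U i).card : ℝ) ≤ 2 * ((U i).card / 2 : ℕ) + 1 := by
    exact_mod_cast (by omega : (U i).card ≤ 2 * ((U i).card / 2) + 1)
  have h3 : Real.exp (-(s * ((U i).card / 2 : ℕ))) ≤
      Real.exp (s / 2) * Real.exp (-(s / 2)) ^ (U i).card := by
    rw [← Real.exp_nat_mul, ← Real.exp_add, Real.exp_le_exp]
    nlinarith
  calc _ ≤ p ^ (U i).card * (1 - p) ^ (Fintype.card V - (U i).card) *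
        (Real.exp (s / 2) * Real.exp (-(s / 2)) ^ (U i).card) := by gcongr
    _ = _ := by rw [mul_pow]; ring

/-- The graph with the given set of edges. -/
def pairGraph {V : Type*} (S : Finset (VertexPair V)) : SimpleGraph V where
  Adj u v := ∃ e ∈ S, e.1 = s(u, v)
  symm := ⟨fun _ _ ⟨e, he, h⟩ => ⟨e, he, h.trans Sym2.eq_swap⟩⟩
  loopless := ⟨fun _ ⟨e, _, h⟩ => e.2 (h ▸ Sym2.mk_isDiag_iff.2 rfl)⟩

lemma pairGraph_mono {V : Type*} : Monotone (pairGraph (V := V)) :=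
  fun _ _ hST _ _ ⟨e, he, h⟩ => ⟨e, hST he, h⟩

lemma edgeSet_pairGraph {V : Type*} (S : Finset (VertexPair V)) :
    (pairGraph S).edgeSet = Subtype.val '' (S : Set (VertexPair V)) := by
  ext e
  induction e with
  | _ u v => simp [pairGraph]

lemma pairGraph_bijective {V : Type*} [Fintype V] [DecidableEq V] :
    Function.Bijective (pairGraph (V := V)) := by
  constructor
  · intro S T h
    have := congrArg SimpleGraph.edgeSet h
    rw [edgeSet_pairGraph, edgeSet_pairGraph] at this
    exact_mod_cast Subtype.val_injective.image_injective this
  · intro G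
    refine ⟨Finset.univ.filter fun e => e.1 ∈ G.edgeSet, ?_⟩
    rw [← SimpleGraph.edgeSet_inj, edgeSet_pairGraph]
    ext e
    simp only [Finset.coe_filter, Finset.mem_univ, true_and, Set.mem_image, Set.mem_ofPred_eq,
      Subtype.exists, exists_and_left, exists_prop, exists_eq_right_right]
    exact ⟨fun h => h.1, fun h => ⟨h, G.not_isDiag_of_mem_edgeSet h⟩⟩

lemma card_vertexPair (n : ℕ) : Fintype.card (VertexPair (Fin n)) = n.choose 2 := by
  rw [Sym2.card_subtype_not_diag, Fintype.card_fin]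

lemma erProb_eq_sum (n : ℕ) (q : ℝ) (A : Set (SimpleGraph (Fin n))) :
    erProb n q A = ∑ S : Finset (VertexPair (Fin n)), (if pairGraph S ∈ A then 1 else 0) *
      (q ^ S.card * (1 - q) ^ (Fintype.card (VertexPair (Fin n)) - S.card)) := by
  rw [erProb, ← pairGraph_bijective.sum_comp]
  refine Finset.sum_congr rfl fun S _ => ?_
  rw [ite_mul, one_mul, zero_mul, erDist, edgeSet_pairGraph,
    Set.ncard_image_of_injective _ Subtype.val_injective, Set.ncard_coe_finset, card_vertexPair]

/-- Transposition of a feature assignment. -/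
def assignTranspose (n m : ℕ) : (Fin n → Finset (Fin m)) ≃ (Fin m → Finset (Fin n)) where
  toFun W w := Finset.univ.filter fun v => w ∈ W v
  invFun U v := Finset.univ.filter fun w => v ∈ U w
  left_inv W := by ext; simp
  right_inv U := by ext; simp

lemma pow_card_mul_pow_eq_prod {α : Type*} [Fintype α] [DecidableEq α] (a b : ℝ) (S : Finset α) :
    a ^ S.card * b ^ (Fintype.card α - S.card) = ∏ x, if x ∈ S then a else b := by
  rw [Finset.prod_ite, Finset.prod_const, Finset.prod_const, Finset.filter_not,
    Finset.filter_mem_eq_inter, Finset.univ_inter, ← Finset.card_univ_sdiff]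

lemma assignWeight_eq (n m : ℕ) (p : ℝ) (W : Fin n → Finset (Fin m)) :
    assignWeight n m p W = ∏ i, p ^ (assignTranspose n m W i).card *
      (1 - p) ^ (Fintype.card (Fin n) - (assignTranspose n m W i).card) := by
  have h (v : Fin n) : p ^ (W v).card * (1 - p) ^ (m - (W v).card)
      = ∏ x, if x ∈ W v then p else 1 - p := by
    rw [← pow_card_mul_pow_eq_prod, Fintype.card_fin]
  rw [assignWeight]
  simp_rw [h, pow_card_mul_pow_eq_prod]
  rw [Finset.prod_comm]
  simp [assignTranspose]

lemma rigGraph_eq (n m : ℕ) (W : Fin n → Finset (Fin m)) :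
    rigGraph n m W =
      pairGraph (Finset.univ.biUnion fun i => cliquePairs (assignTranspose n m W i)) := by
  ext u v
  simp only [rigGraph, SimpleGraph.fromRel_adj, Finset.inter_comm (W v), or_self, pairGraph,
    Finset.mem_biUnion, Finset.mem_univ, true_and, mem_cliquePairs]
  constructor
  · rintro ⟨huv, w, hw⟩
    rw [Finset.mem_inter] at hw
    refine ⟨⟨s(u, v), by simpa using huv⟩, ⟨w, ?_⟩, rfl⟩
    simp [assignTranspose, hw.1, hw.2]
  · rintro ⟨⟨e, he⟩, ⟨w, hw⟩, rfl⟩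
    simp only [Sym2.mem_iff, forall_eq_or_imp, forall_eq, assignTranspose, Equiv.coe_fn_mk,
      Finset.mem_filter, Finset.mem_univ, true_and] at hw
    exact ⟨by simpa using he, w, Finset.mem_inter.2 hw⟩

lemma rigProb_eq_sum (n m : ℕ) (p : ℝ) (A : Set (SimpleGraph (Fin n))) :
    rigProb n m p A = ∑ U : Fin m → Finset (Fin n),
      (∏ i, p ^ (U i).card * (1 - p) ^ (Fintype.card (Fin n) - (U i).card)) *
        (if pairGraph (Finset.univ.biUnion fun i => cliquePairs (U i)) ∈ A then 1 else 0) := by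
  rw [rigProb, ← (assignTranspose n m).sum_comp]
  refine Finset.sum_congr rfl fun W _ => ?_
  rw [← rigGraph_eq, ← assignWeight_eq, mul_ite, mul_one, mul_zero]

lemma sum_prod_weight_eq_one {V : Type*} [Fintype V] (p : ℝ) (m : ℕ) :
    ∑ U : Fin m → Finset V, ∏ i, p ^ (U i).card * (1 - p) ^ (Fintype.card V - (U i).card)
      = 1 := by
  rw [← Fintype.sum_pow fun U : Finset V => p ^ U.card * (1 - p) ^ (Fintype.card V - U.card),
    Fintype.sum_pow_mul_eq_add_pow]
  simp

lemma rigProb_le_one {n m : ℕ} {p : ℝ} (hp0 : 0 ≤ p) (hp1 : p ≤ 1)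
    (A : Set (SimpleGraph (Fin n))) : rigProb n m p A ≤ 1 := by
  have hp : 0 ≤ 1 - p := sub_nonneg.2 hp1
  rw [rigProb_eq_sum]
  refine le_of_le_of_eq ?_ (sum_prod_weight_eq_one (V := Fin n) p m)
  refine Finset.sum_le_sum fun U _ => mul_le_of_le_one_right ?_ ?_
  · exact Finset.prod_nonneg fun i _ => by positivity
  · split_ifs <;> norm_num

/-- Quantitative comparison of the two random graph models on an increasing property. -/
lemma erProb_sub_le_rigProb {n m : ℕ} (hn : 2 ≤ n) {p q s : ℝ} (hp0 : 0 ≤ p) (hp1 : p ≤ 1)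
    (hq0 : 0 ≤ q) (hq1 : q < 1) (hs : 0 ≤ s) {A : Set (SimpleGraph (Fin n))}
    (hA : ∀ G G' : SimpleGraph (Fin n), G ∈ A → G ≤ G' → G' ∈ A) :
    erProb n q A - Real.exp (n.choose 2 * -Real.log (1 - q) * (Real.exp s - 1) - s) *
      (Real.exp (s / 2) * (p * Real.exp (-(s / 2)) + (1 - p)) ^ n) ^ m ≤ rigProb n m p A := by
  have hE : Nonempty (VertexPair (Fin n)) := by
    rw [← Fintype.card_pos_iff, card_vertexPair]
    exact Nat.choose_pos hn
  have hp : 0 ≤ 1 - p := sub_nonneg.2 hp1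
  set φ : Finset (VertexPair (Fin n)) → ℝ := fun S => if pairGraph S ∈ A then 1 else 0 with hφ
  have hmono : Monotone φ := by
    intro S T hST
    by_cases h : pairGraph S ∈ A
    · simp [hφ, h, hA _ _ h (pairGraph_mono hST)]
    · simp only [hφ, h, if_false]
      split_ifs <;> norm_num
  have h0 : 0 ≤ φ := fun S => by simp only [hφ, Pi.zero_apply]; split_ifs <;> norm_num
  have h1 : φ ≤ 1 := fun S => by simp only [hφ, Pi.one_apply]; split_ifs <;> norm_num
  have ht : 0 ≤ -Real.log (1 - q) :=
    neg_nonneg.2 (Real.log_nonpos (by linarith) (by linarith))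
  have hpois := poisson_sub_le_insertAvg_iterate hmono h0 h1 ht hs
  rw [neg_neg, Real.exp_log (by linarith), card_vertexPair, sub_sub_cancel] at hpois
  have her := erProb_eq_sum n q A
  rw [card_vertexPair] at her
  change erProb n q A = ∑ S, φ S * _ at her
  rw [← her] at hpois
  have hdom := sum_prod_weight_insertAvg_iterate_le (V := Fin n)
    (w := fun k => p ^ k * (1 - p) ^ (Fintype.card (Fin n) - k))
    (fun k _ => by positivity) m hmono ∅
  simp only [Finset.empty_union] at hdom
  rw [rigProb_eq_sum]
  refine le_trans ?_ hdom
  set c := Real.exp (n.choose 2 * -Real.log (1 - q) * (Real.exp s - 1) - s)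
  have hmgf := mul_le_mul_of_nonneg_left
    (sum_prod_weight_exp_le (V := Fin n) hp0 hp1 m hs) (Real.exp_pos _ : 0 < c).le
  rw [Fintype.card_fin] at hmgf ⊢
  calc _ ≤ erProb n q A * 1 - c * ∑ U : Fin m → Finset (Fin n),
          (∏ i, p ^ (U i).card * (1 - p) ^ (n - (U i).card)) *
            Real.exp (-(s * (∑ i, (U i).card / 2 : ℕ))) := by linarith
    _ = ∑ U : Fin m → Finset (Fin n), (∏ i, p ^ (U i).card * (1 - p) ^ (n - (U i).card)) *
          (erProb n q A - c * Real.exp (-(s * (∑ i, (U i).card / 2 : ℕ)))) := by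
        have := sum_prod_weight_eq_one (V := Fin n) p m
        rw [Fintype.card_fin] at this
        rw [congrArg (erProb n q A * ·) this.symm, Finset.mul_sum, Finset.mul_sum, ← Finset.sum_sub_distrib]
        exact Finset.sum_congr rfl fun U _ => by ring
    _ ≤ _ := Finset.sum_le_sum fun U _ => mul_le_mul_of_nonneg_left (hpois _)
        (Finset.prod_nonneg fun i _ => by positivity)

/-- The exponential error term is small once the mean `l` of the Poisson variable is below the
mean number of pairs by a large multiple of the standard deviation. -/
lemma exp_error_le {n m : ℕ} {p l w : ℝ} (hp0 : 0 ≤ p) (hp1 : p ≤ 1) (hl0 : 0 ≤ l)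
    (hw : 0 ≤ w) (hμ : 1 ≤ (m : ℝ) * n * p)
    (hl : l ≤ ((m : ℝ) * n * p - w * √((m : ℝ) * n * p) - m) / 2) {s : ℝ}
    (hs : s = (√((m : ℝ) * n * p))⁻¹) :
    Real.exp (l * (Real.exp s - 1) - s) *
      (Real.exp (s / 2) * (p * Real.exp (-(s / 2)) + (1 - p)) ^ n) ^ m ≤
      Real.exp (1 - w / 2) := by
  set r := √((m : ℝ) * n * p) with hr
  have hr1 : 1 ≤ r := Real.one_le_sqrt.2 hμ
  have hrr : (m : ℝ) * n * p = r * r := (Real.mul_self_sqrt (by linarith)).symm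
  have hs0 : 0 ≤ s := by rw [hs]; positivity
  have hsr : s * r = 1 := by rw [hs]; exact inv_mul_cancel₀ (by positivity)
  have hs1 : s ≤ 1 := by rw [hs]; exact inv_le_one_of_one_le₀ hr1
  have he : Real.exp s - 1 ≤ s + s ^ 2 := by
    have := le_of_abs_le (Real.abs_exp_sub_one_sub_id_le (x := s) (by rwa [abs_of_nonneg hs0]))
    linarith
  have he' : Real.exp (-(s / 2)) - 1 ≤ -(s / 2) + s ^ 2 / 4 := by
    have := le_of_abs_le (Real.abs_exp_sub_one_sub_id_le (x := -(s / 2))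
      (by rw [abs_neg, abs_of_nonneg (by linarith)]; linarith))
    linarith
  have hbase : p * Real.exp (-(s / 2)) + (1 - p) ≤ Real.exp (p * (-(s / 2) + s ^ 2 / 4)) := by
    have := Real.add_one_le_exp (p * (-(s / 2) + s ^ 2 / 4))
    nlinarith
  have hnn : 0 ≤ p * Real.exp (-(s / 2)) + (1 - p) := by
    have := sub_nonneg.2 hp1
    positivity
  calc _ ≤ Real.exp (l * (s + s ^ 2) - s) *
        (Real.exp (s / 2) * Real.exp (p * (-(s / 2) + s ^ 2 / 4)) ^ n) ^ m := by
        gcongr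
    _ = Real.exp (l * (s + s ^ 2) - s + m * (s / 2) +
          (m * n * p) * (-(s / 2) + s ^ 2 / 4)) := by
        rw [← Real.exp_nat_mul, ← Real.exp_add, ← Real.exp_nat_mul, ← Real.exp_add]
        ring_nf
    _ ≤ _ := by
        rw [Real.exp_le_exp, hrr]
        rw [hrr] at hl
        have h1 : l * s ≤ (r - w - m * s) / 2 := by
          have := mul_le_mul_of_nonneg_right hl hs0
          have h2 : (r * r - w * r - m) / 2 * s = (r * (s * r) - w * (s * r) - m * s) / 2 := by
            ring
          rw [h2, hsr] at this
          linarith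
        have h2 : l * s ^ 2 ≤ 1 / 2 := by
          have h3 : l ≤ r * r / 2 := by
            have : 0 ≤ w * r := by positivity
            have : (0 : ℝ) ≤ m := by positivity
            linarith
          have := mul_le_mul_of_nonneg_right h3 (sq_nonneg s)
          have h4 : r * r / 2 * s ^ 2 = (s * r) ^ 2 / 2 := by ring
          rw [h4, hsr] at this
          linarith
        have h3 : r * r * (-(s / 2) + s ^ 2 / 4) = -(r * (s * r)) / 2 + (s * r) ^ 2 / 4 := by
          ring
        rw [h3, hsr]
        linarith

lemma choose_mul_neg_log_le {n m : ℕ} {p w q : ℝ} (hn : 2 ≤ n)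
    (hmp : (m : ℝ) * p ^ 2 < 1) (hnp : 6 ≤ n * p) (hμ : 0 < (m : ℝ) * n * p)
    (hw : 0 ≤ w)
    (hq : q = ((m : ℝ) * p / n) * (1 - w / √((m : ℝ) * n * p) - 2 / (n * p) - m * p / (2 * n)))
    (hq0 : 0 ≤ q) :
    n.choose 2 * -Real.log (1 - q) ≤ ((m : ℝ) * n * p - w * √((m : ℝ) * n * p) - m) / 2 := by
  have hn0 : (0 : ℝ) < n := by positivity
  have hp : 0 < p := pos_of_mul_pos_right (by linarith) hn0.le
  set r := √((m : ℝ) * n * p) with hr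
  have hr0 : 0 < r := Real.sqrt_pos.2 hμ
  have hrr : (m : ℝ) * n * p = r * r := (Real.mul_self_sqrt hμ.le).symm
  set a := (m : ℝ) * p / n with ha
  set b := 1 / (n * p) with hb
  have ha0 : 0 ≤ a := by positivity
  have hb0 : 0 < b := by positivity
  have hb6 : b ≤ 1 / 6 := one_div_le_one_div_of_le (by norm_num) hnp
  have hab : a ≤ b := by
    rw [ha, hb, div_le_div_iff₀ hn0 (by positivity)]
    nlinarith
  have hq' : q = a * (1 - w / r - 2 * b - a / 2) := by
    rw [hq, ha, hb]
    ring
  have hwr : 0 ≤ w / r := by positivity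
  have hqa : q ≤ a := by
    rw [hq']
    exact mul_le_of_le_one_right ha0 (by linarith)
  have hlog : -Real.log (1 - q) ≤ a * (1 - w / r - b) := by
    have h1 := Real.one_sub_inv_le_log_of_pos (x := 1 - q) (by linarith)
    have h2 : (1 - q)⁻¹ ≤ 1 + q + a * (3 / 2 * a) := by
      rw [inv_le_iff_one_le_mul₀ (by linarith)]
      nlinarith [mul_le_mul hqa hqa hq0 ha0]
    nlinarith
  have hlog0 : 0 ≤ -Real.log (1 - q) :=
    neg_nonneg.2 (Real.log_nonpos (by linarith) (by linarith))
  calc _ ≤ (n : ℝ) ^ 2 / 2 * (a * (1 - w / r - b)) := by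
        refine mul_le_mul ?_ hlog hlog0 (by positivity)
        rw [Nat.cast_choose_two]
        nlinarith
    _ = _ := by
        have h1 : (n : ℝ) ^ 2 * a = m * n * p := by rw [ha]; field_simp
        have h2 : (m : ℝ) * n * p * b = m := by rw [hb]; field_simp
        have h3 : (m : ℝ) * n * p * (w / r) = w * r := by rw [hrr]; field_simp
        linear_combination (1 - w / r - b) / 2 * h1 - h2 / 2 - h3 / 2

/-- Coupling lemma, case `np → ∞`: if `A` is an increasing graph property, `m p² < 1`,
`n p → ∞`, `ω → ∞` with `ω = o(√(m n p))`, and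
`p̂₋ = (m p / n)(1 - ω/√(m n p) - 2/(n p) - m p/(2 n))`, then whp-transfer holds:
if `G(n, p̂₋) ∈ A` whp, then the random intersection graph `G(n, m, p) ∈ A` whp. -/
theorem rig_coupling_large_np
    (A : ∀ n : ℕ, Set (SimpleGraph (Fin n)))
    (hIso : ∀ (n : ℕ) (G G' : SimpleGraph (Fin n)), Nonempty (G ≃g G') →
      G ∈ A n → G' ∈ A n)
    (hIncr : ∀ (n : ℕ) (G G' : SimpleGraph (Fin n)), G ∈ A n → G ≤ G' → G' ∈ A n)
    (m : ℕ → ℕ) (p : ℕ → ℝ)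
    (hp0 : ∀ n, 0 ≤ p n) (hp1 : ∀ n, p n ≤ 1)
    (hmp : ∀ n, (m n : ℝ) * p n ^ 2 < 1)
    (hnp : Tendsto (fun n : ℕ => (n : ℝ) * p n) atTop atTop)
    (ω : ℕ → ℝ) (hω : Tendsto ω atTop atTop)
    (hωo : Tendsto (fun n : ℕ => ω n / Real.sqrt ((m n : ℝ) * n * p n)) atTop (nhds 0))
    (phat : ℕ → ℝ)
    (hphat : ∀ n : ℕ, phat n =
      ((m n : ℝ) * p n / n) *
        (1 - ω n / Real.sqrt ((m n : ℝ) * n * p n) - 2 / ((n : ℝ) * p n)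
          - (m n : ℝ) * p n / (2 * n)))
    (hER : Tendsto (fun n => erProb n (phat n) (A n)) atTop (nhds 1)) :
    Tendsto (fun n => rigProb n (m n) (p n) (A n)) atTop (nhds 1) := by
  have hexp : Tendsto (fun n => Real.exp (1 - ω n / 2)) atTop (nhds 0) := by
    refine Real.tendsto_exp_atBot.comp ?_
    simp_rw [sub_eq_add_neg]
    exact tendsto_atBot_add_const_left _ _
      (tendsto_neg_atTop_atBot.comp (hω.atTop_div_const two_pos))
  refine tendsto_of_tendsto_of_tendsto_of_le_of_le' (by simpa using hER.sub hexp)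
    tendsto_const_nhds ?_ (Eventually.of_forall fun n => rigProb_le_one (hp0 n) (hp1 n) _)
  filter_upwards [eventually_ge_atTop 2, hnp.eventually_ge_atTop 6, hω.eventually_ge_atTop 1,
    hωo.eventually_le_const (by norm_num : (0 : ℝ) < 1 / 3)] with n hn hnp6 hω1 hω3
  rcases Nat.eq_zero_or_pos (m n) with hm | hm
  · have h := erProb_sub_le_rigProb (m := m n) hn (hp0 n) (hp1 n) le_rfl zero_lt_one
      (zero_le_one.trans hω1) (hIncr n)
    have hq : phat n = 0 := by simp [hphat, hm]
    rw [hq]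
    refine le_trans ?_ h
    simp only [hm, sub_zero, Real.log_one, neg_zero, mul_zero, zero_mul, pow_zero, mul_one,
      zero_sub]
    gcongr
    linarith
  · have hn0 : (0 : ℝ) < n := by positivity
    have hm0 : (0 : ℝ) < m n := Nat.cast_pos.2 hm
    have hp : 0 < p n := pos_of_mul_pos_right (by linarith) hn0.le
    have hμ : 0 < (m n : ℝ) * n * p n := by positivity
    have hr : 1 ≤ √((m n : ℝ) * n * p n) := by
      rw [div_le_iff₀ (Real.sqrt_pos.2 hμ)] at hω3
      linarith
    have hsmall : (m n : ℝ) * p n / n ≤ 1 / (n * p n) := by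
      rw [div_le_div_iff₀ hn0 (by positivity)]
      nlinarith [hmp n]
    have hinv : 1 / (n * p n) ≤ 1 / 6 := one_div_le_one_div_of_le (by norm_num) hnp6
    have h2 : 2 / (n * p n) = 2 * (1 / (n * p n)) := by ring
    have h3 : (m n : ℝ) * p n / (2 * n) = (m n * p n / n) / 2 := by ring
    have ha0 : 0 ≤ (m n : ℝ) * p n / n := by positivity
    have hω0 : 0 ≤ ω n / √((m n : ℝ) * n * p n) := div_nonneg (by linarith) (by positivity)
    have hq0 : 0 ≤ phat n := by
      rw [hphat, h2, h3]
      exact mul_nonneg ha0 (by linarith)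
    have hq1 : phat n < 1 := by
      refine lt_of_le_of_lt (b := (m n : ℝ) * p n / n) ?_ (by linarith)
      rw [hphat, h2, h3]
      exact mul_le_of_le_one_right ha0 (by linarith)
    have hl0 : 0 ≤ n.choose 2 * -Real.log (1 - phat n) := mul_nonneg (by positivity)
      (neg_nonneg.2 (Real.log_nonpos (by linarith) (by linarith)))
    have h := erProb_sub_le_rigProb (m := m n) hn (hp0 n) (hp1 n) hq0 hq1
      (inv_nonneg.2 (Real.sqrt_nonneg ((m n : ℝ) * n * p n))) (hIncr n)
    refine le_trans (sub_le_sub_left ?_ _) h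
    exact exp_error_le (hp0 n) (hp1 n) hl0 (by linarith) (Real.one_le_sqrt.1 hr)
      (choose_mul_neg_log_le hn (hmp n) hnp6 hμ (by linarith) (hphat n) hq0) rfl
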